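/- The group Ŵ_{r,n} presented by generators t_1, ..., t_n, ρ, s_0, ..., s_{n-1} with relations s_i^2 = 1, s_i s_j = s_j s_i if i-j ≢ ±1 (mod n), s_i s_{i+1} s_i = s_{i+1} s_i s_{i+1} (indices mod n), ρ s_i = s_{i-1} ρ (indices mod n), t_i^r = 1, t_i t_j = t_j t_i, s_i t_j = t_{s_i(j)} s_i for 1 ≤ i ≤ n-1, and ρ t_j = t_{j-1} ρ (with t_0 := t_n), is isomorphic to the semidirect product ((ℤ/rℤ)^n × ℤ^n) ⋊ S_n, where S_n acts diagonally by permuting coordinates of both factors. -/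

import Mathlib

/-- The action of a permutation of `ι` on `ι → M` by permuting coordinates. -/
def permAut (ι M : Type*) [Group M] : Equiv.Perm ι →* MulAut (ι → M) where
  toFun σ :=
    { toFun := fun f => f ∘ σ.symm
      invFun := fun f => f ∘ σ
      left_inv := fun f => by ext x; simp
      right_inv := fun f => by ext x; simp
      map_mul' := fun f g => rfl }
  map_one' := by ext f x; rfl
  map_mul' := fun σ τ => by ext f x; rfl

/-- The semidirect product `((ℤ/rℤ)^n × ℤ^n) ⋊ S_n`, with `S_n` acting diagonally by
permuting the coordinates of both factors (realized as
`(Fin n → (ℤ/rℤ) × ℤ) ⋊ S_n` with the coordinate-permutation action). -/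
abbrev WTilde (r n : ℕ) :=
  SemidirectProduct (Fin n → Multiplicative (ZMod r) × Multiplicative ℤ)
    (Equiv.Perm (Fin n))
    (permAut (Fin n) (Multiplicative (ZMod r) × Multiplicative ℤ))

/-- The free-group generator corresponding to `t_j`. -/
def Tg (n : ℕ) (j : Fin n) : FreeGroup (Fin n ⊕ Option (Fin n)) :=
  FreeGroup.of (Sum.inl j)

/-- The free-group generator corresponding to `s_i`. -/
def Sg (n : ℕ) (i : Fin n) : FreeGroup (Fin n ⊕ Option (Fin n)) :=
  FreeGroup.of (Sum.inr (some i))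

/-- The free-group generator corresponding to `ρ`. -/
def Pg (n : ℕ) : FreeGroup (Fin n ⊕ Option (Fin n)) :=
  FreeGroup.of (Sum.inr none)

/-- The defining relations of `Ŵ_{r,n}`: `s_i² = 1`; `s_i s_j = s_j s_i` if
`i - j ≢ ±1 (mod n)`; `s_i s_{i+1} s_i = s_{i+1} s_i s_{i+1}` (indices mod `n`);
`ρ s_i = s_{i-1} ρ` (indices mod `n`); `t_j^r = 1`; `t_j t_k = t_k t_j`;
`s_i t_j = t_{s_i(j)} s_i` for `1 ≤ i ≤ n-1` (where `s_i` acts as the transposition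
`(i-1, i)` in `0`-indexed notation); and `ρ t_j = t_{j-1} ρ` (with `t_0 := t_n`,
i.e. indices mod `n`). -/
def WTrels (r n : ℕ) [NeZero n] : Set (FreeGroup (Fin n ⊕ Option (Fin n))) :=
  {x | ∃ i : Fin n, x = Sg n i * Sg n i} ∪
  {x | ∃ i j : Fin n, i ≠ j + 1 ∧ j ≠ i + 1 ∧
    x = Sg n i * Sg n j * (Sg n j * Sg n i)⁻¹} ∪
  {x | ∃ i : Fin n,
    x = Sg n i * Sg n (i+1) * Sg n i * (Sg n (i+1) * Sg n i * Sg n (i+1))⁻¹} ∪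
  {x | ∃ i : Fin n, x = Pg n * Sg n i * (Sg n (i-1) * Pg n)⁻¹} ∪
  {x | ∃ j : Fin n, x = (Tg n j) ^ r} ∪
  {x | ∃ j k : Fin n, x = Tg n j * Tg n k * (Tg n k * Tg n j)⁻¹} ∪
  {x | ∃ i j : Fin n, i ≠ 0 ∧
    x = Sg n i * Tg n j * (Tg n (Equiv.swap (i - 1) i j) * Sg n i)⁻¹} ∪
  {x | ∃ j : Fin n, x = Pg n * Tg n j * (Tg n (j - 1) * Pg n)⁻¹}

open Equiv

section cox
variable {G : Type*} [Group G]

/-- parabolic subgroup -/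
def coxG (s : ℕ → G) (k : ℕ) : Subgroup G := Subgroup.closure {x | ∃ j, j < k ∧ x = s j}

theorem coxG_mono (s : ℕ → G) {k l : ℕ} (h : k ≤ l) : coxG s k ≤ coxG s l := by
  apply Subgroup.closure_mono
  rintro x ⟨j, hj, rfl⟩
  exact ⟨j, by omega, rfl⟩

theorem coxG_mem (s : ℕ → G) {k j : ℕ} (h : j < k) : s j ∈ coxG s k :=
  Subgroup.subset_closure ⟨j, h, rfl⟩

theorem coxG_comm (s : ℕ → G) (m : ℕ)
    (hc : ∀ i j, i + 1 < j → j < m → s i * s j = s j * s i) (k : ℕ) (hk : k + 1 < m)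
    (a : G) (ha : a ∈ coxG s k) : a * s (k+1) = s (k+1) * a := by
  have : coxG s k ≤ Subgroup.centralizer {s (k+1)} := by
    refine (Subgroup.closure_le _).2 ?_
    rintro x ⟨j, hj, rfl⟩
    rw [SetLike.mem_coe, Subgroup.mem_centralizer_singleton_iff]
    exact (hc j (k+1) (by omega) hk)
  have h2 := this ha
  rw [Subgroup.mem_centralizer_singleton_iff] at h2
  exact h2

theorem coxG_double (s : ℕ → G) (m : ℕ) (hs : ∀ k, k < m → s k * s k = 1)
    (hb : ∀ k, k + 1 < m → s k * s (k+1) * s k = s (k+1) * s k * s (k+1))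
    (hc : ∀ i j, i + 1 < j → j < m → s i * s j = s j * s i) (k : ℕ) (hk : k < m) :
    ∀ w ∈ coxG s (k+1), w ∈ coxG s k ∨ ∃ a ∈ coxG s k, ∃ b ∈ coxG s k, w = a * s k * b := by
  induction k with
  | zero =>
    intro w hw
    have h0 : s 0 * s 0 = 1 := hs 0 hk
    have hw' : w ∈ Subgroup.zpowers (s 0) := by
      rw [Subgroup.zpowers_eq_closure]
      convert hw using 2
      ext x
      unfold coxG
      simp
    obtain ⟨z, rfl⟩ := Subgroup.mem_zpowers_iff.1 hw'
    rcases Int.even_or_odd' z with ⟨y, rfl | rfl⟩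
    · left
      rw [zpow_mul, zpow_two, h0, one_zpow]; exact one_mem _
    · right
      refine ⟨1, one_mem _, 1, one_mem _, ?_⟩
      rw [zpow_add, zpow_mul, zpow_two, h0]; simp
  | succ k ih =>
    have ih := ih (by omega)
    -- key: s (k+1) * u * s (k+1) is in the set
    have key : ∀ u ∈ coxG s (k+1), s (k+1) * u * s (k+1) ∈ coxG s (k+1) ∨
        ∃ a ∈ coxG s (k+1), ∃ b ∈ coxG s (k+1), s (k+1) * u * s (k+1) = a * s (k+1) * b := by
      intro u hu
      rcases ih u hu with h | ⟨a, ha, b, hb', rfl⟩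
      · left
        rw [← coxG_comm s m hc k hk u h, mul_assoc, hs _ hk, mul_one]
        exact hu
      · right
        refine ⟨a * s k, mul_mem (coxG_mono s (by omega) ha) (coxG_mem s (by omega)),
          s k * b, mul_mem (coxG_mem s (by omega)) (coxG_mono s (by omega) hb'), ?_⟩
        have e1 := coxG_comm s m hc k hk a ha
        have e2 := coxG_comm s m hc k hk b hb'
        calc s (k+1) * (a * s k * b) * s (k+1)
            = (s (k+1) * a) * s k * (b * s (k+1)) := by group
          _ = (a * s (k+1)) * s k * (s (k+1) * b) := by rw [e1, e2]
          _ = a * (s (k+1) * s k * s (k+1)) * b := by group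
          _ = a * (s k * s (k+1) * s k) * b := by rw [hb k hk]
          _ = _ := by group
    intro w hw
    have hstep : ∀ (w : G), (w ∈ coxG s (k+1) ∨
        ∃ a ∈ coxG s (k+1), ∃ b ∈ coxG s (k+1), w = a * s (k+1) * b) → ∀ j, j < k + 2 →
        (w * s j ∈ coxG s (k+1) ∨
        ∃ a ∈ coxG s (k+1), ∃ b ∈ coxG s (k+1), w * s j = a * s (k+1) * b) := by
      intro w hw j hj
      rcases Nat.lt_or_ge j (k+1) with hj' | hj'
      · have hm := coxG_mem s hj'
        rcases hw with hw | ⟨a, ha, b, hb', rfl⟩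
        · exact Or.inl (mul_mem hw hm)
        · exact Or.inr ⟨a, ha, b * s j, mul_mem hb' hm, by group⟩
      · obtain rfl : j = k + 1 := by omega
        rcases hw with hw | ⟨a, ha, b, hb', rfl⟩
        · exact Or.inr ⟨w, hw, 1, one_mem _, by group⟩
        · have e : a * s (k+1) * b * s (k+1) = a * (s (k+1) * b * s (k+1)) := by group
          rw [e]
          rcases key b hb' with h | ⟨a', ha', b', hb'', h⟩
          · exact Or.inl (mul_mem ha h)
          · rw [h]
            exact Or.inr ⟨a * a', mul_mem ha ha', b', hb'', by group⟩
    refine Subgroup.closure_induction_right (p := fun w _ => w ∈ coxG s (k+1) ∨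
        ∃ a ∈ coxG s (k+1), ∃ b ∈ coxG s (k+1), w = a * s (k+1) * b) (Or.inl (one_mem _)) ?_ ?_ hw
    · rintro x hx y ⟨j, hj, rfl⟩ h
      exact hstep x h j hj
    · rintro x hx y ⟨j, hj, rfl⟩ h
      have : (s j)⁻¹ = s j := inv_eq_of_mul_eq_one_left (hs j (by omega))
      rw [this]
      exact hstep x h j hj

theorem coxG_fix (m : ℕ) (s : ℕ → G) (f : G →* Perm (Fin (m+1)))
    (hf : ∀ k (h : k < m), f (s k) = swap ⟨k, by omega⟩ ⟨k+1, by omega⟩) (k : ℕ) (_hk : k ≤ m)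
    (w : G) (hw : w ∈ coxG s k) : ∀ l (hl : l < m + 1), k < l → f w ⟨l, hl⟩ = ⟨l, hl⟩ := by
  intro l hl hkl
  induction hw using Subgroup.closure_induction with
  | mem x hx =>
    obtain ⟨j, hj, rfl⟩ := hx
    rw [hf j (by omega), swap_apply_of_ne_of_ne] <;> simp <;> omega
  | one => simp
  | mul x y _ _ h1 h2 => rw [map_mul, Perm.mul_apply, h2, h1]
  | inv x _ h => rw [map_inv, Perm.inv_eq_iff_eq, h]

theorem coxG_stab (m : ℕ) (s : ℕ → G) (hs : ∀ k, k < m → s k * s k = 1)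
    (hb : ∀ k, k + 1 < m → s k * s (k+1) * s k = s (k+1) * s k * s (k+1))
    (hc : ∀ i j, i + 1 < j → j < m → s i * s j = s j * s i) (f : G →* Perm (Fin (m+1)))
    (hf : ∀ k (h : k < m), f (s k) = swap ⟨k, by omega⟩ ⟨k+1, by omega⟩) (k : ℕ) (hk : k < m)
    (w : G) (hw : w ∈ coxG s (k+1)) (h : f w ⟨k+1, by omega⟩ = ⟨k+1, by omega⟩) :
    w ∈ coxG s k := by
  rcases coxG_double s m hs hb hc k hk w hw with h' | ⟨a, ha, b, hb', rfl⟩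
  · exact h'
  · exfalso
    have h1 := coxG_fix m s f hf k hk.le a ha (k+1) (by omega) (by omega)
    have h2 := coxG_fix m s f hf k hk.le b hb' (k+1) (by omega) (by omega)
    rw [map_mul, map_mul, Perm.mul_apply, Perm.mul_apply, h2, hf k hk, swap_apply_right] at h
    have := (f a).injective (h.trans h1.symm)
    simp at this

theorem coxG_inj (m : ℕ) (s : ℕ → G) (hs : ∀ k, k < m → s k * s k = 1)
    (hb : ∀ k, k + 1 < m → s k * s (k+1) * s k = s (k+1) * s k * s (k+1))
    (hc : ∀ i j, i + 1 < j → j < m → s i * s j = s j * s i) (f : G →* Perm (Fin (m+1)))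
    (hf : ∀ k (h : k < m), f (s k) = swap ⟨k, by omega⟩ ⟨k+1, by omega⟩) (k : ℕ) (hk : k ≤ m)
    (w : G) (hw : w ∈ coxG s k) (h : f w = 1) : w = 1 := by
  induction k with
  | zero => simpa [coxG] using hw
  | succ k ih =>
    exact ih (by omega) (coxG_stab m s hs hb hc f hf k (by omega) w hw (by simp [h]))

/-- the simple transposition `(k, k+1)` (or `1` out of range) -/
def swp (m k : ℕ) : Perm (Fin (m+1)) :=
  if h : k < m then swap ⟨k, by omega⟩ ⟨k+1, by omega⟩ else 1

theorem swp_eq (m k : ℕ) (h : k < m) : swp m k = swap ⟨k, by omega⟩ ⟨k+1, by omega⟩ := by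
  simp [swp, h]

theorem swp_sq (m k : ℕ) : swp m k * swp m k = 1 := by
  unfold swp; split_ifs <;> simp

theorem swap_braid {α : Type*} [DecidableEq α] {a b c : α} (h1 : a ≠ b) (h2 : a ≠ c)
    (h3 : b ≠ c) : swap a b * swap b c * swap a b = swap b c * swap a b * swap b c := by
  have e1 : swap a b * swap b c * (swap a b)⁻¹ = swap a c := by
    rw [← swap_apply_apply, swap_apply_right, swap_apply_of_ne_of_ne h2.symm h3.symm]
  have e2 : swap b c * swap a b * (swap b c)⁻¹ = swap a c := by
    rw [← swap_apply_apply, swap_apply_left, swap_apply_of_ne_of_ne h1 h2]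
  rw [swap_inv] at e1 e2
  rw [e1, e2]

theorem swp_braid (m k : ℕ) (h : k + 1 < m) :
    swp m k * swp m (k+1) * swp m k = swp m (k+1) * swp m k * swp m (k+1) := by
  rw [swp_eq m k (by omega), swp_eq m (k+1) h]
  apply swap_braid <;> simp [Fin.ext_iff] <;> omega

theorem swp_comm (m i j : ℕ) (h : i + 1 < j) (h' : j < m) :
    swp m i * swp m j = swp m j * swp m i := by
  rw [swp_eq m i (by omega), swp_eq m j h']
  refine (Perm.Disjoint.commute ?_)
  intro x
  by_cases h1 : x = ⟨i, by omega⟩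
  · right; subst h1; rw [swap_apply_of_ne_of_ne] <;> simp <;> omega
  by_cases h2 : x = ⟨i+1, by omega⟩
  · right; subst h2; rw [swap_apply_of_ne_of_ne] <;> simp <;> omega
  left; rw [swap_apply_of_ne_of_ne h1 h2]

theorem swp_top (m : ℕ) : coxG (swp m) m = ⊤ := by
  rw [eq_top_iff]
  intro σ _
  have h := Equiv.Perm.mclosure_swap_castSucc_succ m
  have h2 : σ ∈ Submonoid.closure (Set.range fun i : Fin m ↦ swap i.castSucc i.succ) := by
    rw [h]; trivial
  have h3 : Submonoid.closure (Set.range fun i : Fin m ↦ swap i.castSucc i.succ)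
      ≤ (coxG (swp m) m).toSubmonoid := by
    rw [Submonoid.closure_le]
    rintro _ ⟨i, rfl⟩
    have := coxG_mem (swp m) i.2
    rw [swp_eq m i i.2] at this
    exact this
  exact h3 h2

theorem swp_stab (m : ℕ) (σ : Perm (Fin (m+2))) (h : σ (Fin.last (m+1)) = Fin.last (m+1)) :
    σ ∈ coxG (swp (m+1)) m := by
  refine coxG_stab (m+1) (swp (m+1)) (fun k _ => swp_sq _ k) (fun k => swp_braid _ k)
    (fun i j => swp_comm _ i j) (MonoidHom.id _) (fun k h => swp_eq _ k h) m (by omega) σ ?_ h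
  rw [swp_top]; trivial

theorem coxLift (m : ℕ) (s : ℕ → G) (hs : ∀ k, k < m → s k * s k = 1)
    (hb : ∀ k, k + 1 < m → s k * s (k+1) * s k = s (k+1) * s k * s (k+1))
    (hc : ∀ i j, i + 1 < j → j < m → s i * s j = s j * s i) :
    ∃ g : Perm (Fin (m+1)) →* G, ∀ k, k < m → g (swp m k) = s k := by
  let s' : ℕ → G × Perm (Fin (m+1)) := fun k => (s k, swp m k)
  let f : coxG s' m →* Perm (Fin (m+1)) := (MonoidHom.snd G _).comp (coxG s' m).subtype
  have hinj : Function.Injective f := by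
    rw [injective_iff_map_eq_one]
    rintro ⟨w, hw⟩ h
    have := coxG_inj m s' (fun k hk => Prod.ext (hs k hk) (swp_sq m k))
      (fun k hk => Prod.ext (hb k hk) (swp_braid m k hk))
      (fun i j h1 h2 => Prod.ext (hc i j h1 h2) (swp_comm m i j h1 h2))
      (MonoidHom.snd G _) (fun k h => swp_eq m k h) m le_rfl w hw h
    exact Subtype.ext this
  have hsurj : Function.Surjective f := by
    rw [← MonoidHom.range_eq_top, eq_top_iff, ← swp_top m]
    refine (Subgroup.closure_le _).2 ?_
    rintro x ⟨j, hj, rfl⟩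
    exact ⟨⟨s' j, coxG_mem s' hj⟩, rfl⟩
  let e := MulEquiv.ofBijective f ⟨hinj, hsurj⟩
  refine ⟨((MonoidHom.fst G _).comp (coxG s' m).subtype).comp e.symm.toMonoidHom, ?_⟩
  intro k hk
  have : e.symm (swp m k) = ⟨s' k, coxG_mem s' hk⟩ := by
    rw [MulEquiv.symm_apply_eq]; rfl
  show ((e.symm (swp m k)).1).1 = s k
  rw [this]

end cox

theorem fin_pred (m : ℕ) (i : Fin (m+2)) (hi : i ≠ 0) :
    ∃ k, ∃ h : k < m + 1, i = ⟨k+1, by omega⟩ ∧ i - 1 = ⟨k, by omega⟩ := by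
  obtain ⟨k, rfl⟩ := Fin.exists_succ_eq.2 hi
  refine ⟨k, k.2, rfl, ?_⟩
  rw [sub_eq_iff_eq_add]
  exact (Fin.coeSucc_eq_succ).symm

theorem fin_mk_succ (m k : ℕ) (h : k < m + 1) :
    (⟨k+1, by omega⟩ : Fin (m+2)) - 1 = ⟨k, by omega⟩ := by
  rw [sub_eq_iff_eq_add]
  exact (Fin.coeSucc_eq_succ (a := ⟨k, h⟩)).symm

theorem perm_closure_ind (m : ℕ) (p : Perm (Fin (m+2)) → Prop) (h1 : p 1)
    (hmul : ∀ a b, p a → p b → p (a * b)) (hinv : ∀ a, p a → p a⁻¹)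
    (hs : ∀ i, i ≠ 0 → p (swap (i-1) i)) (σ : Perm (Fin (m+2))) : p σ := by
  have hσ : σ ∈ coxG (swp (m+1)) (m+1) := by rw [swp_top]; trivial
  induction hσ using Subgroup.closure_induction with
  | mem x hx =>
    obtain ⟨j, hj, rfl⟩ := hx
    have := hs ⟨j+1, by omega⟩ (by simp [Fin.ext_iff])
    rw [fin_mk_succ m j hj] at this
    rwa [swp_eq _ _ hj]
  | one => exact h1
  | mul x y _ _ h1 h2 => exact hmul _ _ h1 h2
  | inv x _ h => exact hinv _ h

/-- homomorphism from `(ℤ/r) × ℤ` given by two commuting elements -/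
theorem exists_hom_M {G : Type*} [Group G] (r : ℕ) (t x : G) (ht : t ^ r = 1) (h : Commute t x) :
    ∃ f : Multiplicative (ZMod r) × Multiplicative ℤ →* G,
      ∀ a b : ℤ, f (Multiplicative.ofAdd (a : ZMod r), Multiplicative.ofAdd b) = t ^ a * x ^ b := by
  let f1 : Multiplicative (ZMod r) →* G := AddMonoidHom.toMultiplicativeLeft
    (ZMod.lift r ⟨zmultiplesHom (Additive G) (Additive.ofMul t), by
      simp [← ofMul_pow, ht]⟩)
  have hf1 : ∀ a : ℤ, f1 (Multiplicative.ofAdd (a : ZMod r)) = t ^ a := by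
    intro a
    simp [f1]
  let f2 : Multiplicative ℤ →* G := zpowersHom G x
  have hf2 : ∀ a : ℤ, f2 (Multiplicative.ofAdd a) = x ^ a := by
    intro a
    simp [f2]
  have hcomm : ∀ m n, Commute (f1 m) (f2 n) := by
    intro m n
    obtain ⟨a, ha⟩ := ZMod.intCast_surjective (Multiplicative.toAdd m)
    have : m = Multiplicative.ofAdd (a : ZMod r) := by rw [ha]; rfl
    rw [this, hf1, ← ofAdd_toAdd n, hf2]
    exact h.zpow_zpow _ _
  refine ⟨f1.noncommCoprod f2 hcomm, ?_⟩
  intro a b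
  rw [MonoidHom.noncommCoprod_apply, hf1, hf2]

theorem M_surj (r : ℕ) (z : Multiplicative (ZMod r) × Multiplicative ℤ) :
    ∃ a b : ℤ, z = (Multiplicative.ofAdd (a : ZMod r), Multiplicative.ofAdd b) := by
  obtain ⟨u, v⟩ := z
  obtain ⟨a, ha⟩ := ZMod.intCast_surjective (Multiplicative.toAdd u)
  exact ⟨a, Multiplicative.toAdd v, by rw [ha]; rfl⟩

theorem permAut_mulSingle {ι M : Type*} [DecidableEq ι] [Group M] (σ : Perm ι) (j : ι) (z : M) :
    permAut ι M σ (Pi.mulSingle j z) = Pi.mulSingle (σ j) z := by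
  ext k
  show (Pi.mulSingle j z : ι → M) (σ.symm k) = _
  by_cases h : k = σ j
  · subst h; simp
  · rw [Pi.mulSingle_eq_of_ne h, Pi.mulSingle_eq_of_ne]
    rintro rfl
    simp at h

theorem exists_psi {G : Type*} [Group G] (r m : ℕ) (hm : 1 ≤ m) (t s : Fin (m+2) → G) (p : G)
    (h1 : ∀ i, s i * s i = 1)
    (h2 : ∀ i j, i ≠ j + 1 → j ≠ i + 1 → s i * s j = s j * s i)
    (h3 : ∀ i, s i * s (i+1) * s i = s (i+1) * s i * s (i+1))
    (h4 : ∀ i, p * s i = s (i-1) * p)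
    (h5 : ∀ j, t j ^ r = 1)
    (h6 : ∀ j k, t j * t k = t k * t j)
    (h7 : ∀ i j, i ≠ 0 → s i * t j = t (swap (i-1) i j) * s i)
    (h8 : ∀ j, p * t j = t (j-1) * p) :
    ∃ ψ : WTilde r (m+2) →* G, ∃ x : G,
      (∀ j, ψ (SemidirectProduct.inl
        (Pi.mulSingle j (Multiplicative.ofAdd 1, Multiplicative.ofAdd 0))) = t j) ∧
      (ψ (SemidirectProduct.inl
        (Pi.mulSingle (Fin.last (m+1)) (Multiplicative.ofAdd 0, Multiplicative.ofAdd 1))) = x) ∧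
      (∀ i, i ≠ 0 → ψ (SemidirectProduct.inr (swap (i-1) i)) = s i) ∧
      p = x * ψ (SemidirectProduct.inr (Equiv.subRight 1)) := by
  obtain ⟨g, hg0⟩ := coxLift (m+1) (fun k => if h : k + 1 < m + 2 then s ⟨k+1, h⟩ else 1)
    (by
      intro k hk
      simp only [show k + 1 < m + 2 by omega, dif_pos]
      exact h1 _)
    (by
      intro k hk
      simp only [show k + 1 < m + 2 by omega, show k + 1 + 1 < m + 2 by omega, dif_pos]
      have := h3 ⟨k+1, by omega⟩
      have e : (⟨k+1, by omega⟩ : Fin (m+2)) + 1 = ⟨k+1+1, by omega⟩ := by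
        rw [← fin_mk_succ m (k+1) hk]; simp
      rwa [e] at this)
    (by
      intro i j hi hj
      simp only [show i + 1 < m + 2 by omega, show j + 1 < m + 2 by omega, dif_pos]
      apply h2
      · intro h
        have := (sub_eq_iff_eq_add.2 h)
        rw [fin_mk_succ m i (by omega)] at this
        simp at this; omega
      · intro h
        have := (sub_eq_iff_eq_add.2 h)
        rw [fin_mk_succ m j (by omega)] at this
        simp at this; omega)
  have hg : ∀ i, i ≠ 0 → g (swap (i-1) i) = s i := by
    intro i hi
    obtain ⟨k, hk, e1, e2⟩ := fin_pred m i hi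
    have := hg0 k hk
    rw [swp_eq _ _ hk] at this
    rw [e1, fin_mk_succ m k hk, this]
    simp [hk]
  set L : Fin (m+2) := Fin.last (m+1) with hL
  have hL0 : L ≠ 0 := by simp [hL, Fin.ext_iff]
  have hL1 : L + 1 = 0 := by simp [hL]
  have hL1' : L - 1 ≠ 0 := by
    rw [hL, show Fin.last (m+1) = ⟨m+1, by omega⟩ from rfl, fin_mk_succ m m (by omega)]
    simp [Fin.ext_iff]; omega
  have hLL : L ≠ L - 1 := by
    intro h; have := sub_eq_self.1 h.symm; simp at this
  have h01 : (1 : Fin (m+2)) ≠ 0 := by simp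
  set c : Perm (Fin (m+2)) := Equiv.subRight 1 with hc
  have hcj : ∀ j, c j = j - 1 := fun j => rfl
  have hcj' : ∀ j, c⁻¹ j = j + 1 := fun j => by
    rw [Perm.inv_eq_iff_eq, hcj]; simp
  -- conjugation on t
  have ct : ∀ σ j, g σ * t j = t (σ j) * g σ := by
    intro σ
    refine perm_closure_ind m (fun σ => ∀ j, g σ * t j = t (σ j) * g σ) ?_ ?_ ?_ ?_ σ
    · simp
    · intro a b ha hb j
      rw [map_mul, mul_assoc, hb, ← mul_assoc, ha, mul_assoc]; rfl
    · intro a ha j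
      rw [map_inv, inv_mul_eq_iff_eq_mul, ← mul_assoc, ha, mul_assoc, mul_inv_cancel, mul_one]
      simp
    · intro i hi j
      rw [hg i hi]; exact h7 i j hi
  let x : G := p * g c⁻¹
  have hp : p = x * g c := by simp [x]
  have xt : ∀ j, x * t j = t j * x := by
    intro j
    simp only [x]
    rw [mul_assoc, ct, hcj', ← mul_assoc, h8, mul_assoc]; simp
  have xs0 : ∀ i, i ≠ 0 → i + 1 ≠ 0 → x * s i = s i * x := by
    intro i hi hi'
    have e : swap (i+1-1) (i+1) = c⁻¹ * swap (i-1) i * c := by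
      have := swap_apply_apply c⁻¹ (i-1) i
      rw [hcj', hcj'] at this
      rw [inv_inv] at this
      rw [← this]; simp
    have e2 : s (i+1) = g c⁻¹ * s i * g c := by
      rw [← hg i hi, ← hg (i+1) hi', e, map_mul, map_mul]
    have e3 := h4 (i+1)
    rw [e2, add_sub_cancel_right] at e3
    simp only [x]
    have : p * (g c⁻¹ * s i * g c) * g c⁻¹ = s i * p * g c⁻¹ := by rw [e3]
    simpa [mul_assoc] using this
  have xg : ∀ σ, σ L = L → x * g σ = g σ * x := by
    intro σ hσ
    have := swp_stab m σ hσ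
    clear hσ
    induction this using Subgroup.closure_induction with
    | mem y hy =>
      obtain ⟨j, hj, rfl⟩ := hy
      have hj0 : (⟨j+1, by omega⟩ : Fin (m+2)) ≠ 0 := by simp [Fin.ext_iff]
      have := hg ⟨j+1, by omega⟩ hj0
      rw [swp_eq _ _ (by omega), ← fin_mk_succ m j (by omega), this]
      apply xs0 _ hj0
      rw [← hL1]
      intro h
      have := add_right_cancel h
      simp [hL, Fin.ext_iff] at this
      omega
    | one => simp
    | mul a b _ _ ha hb => rw [map_mul, ← mul_assoc, ha, mul_assoc, hb, mul_assoc]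
    | inv a _ ha =>
      rw [map_inv]
      exact (show Commute x (g a) from ha).inv_right
  let X : Fin (m+2) → G := fun j => g (swap j L) * x * (g (swap j L))⁻¹
  have hX : ∀ σ, X (σ L) = g σ * x * (g σ)⁻¹ := by
    intro σ
    have h := xg ((swap (σ L) L)⁻¹ * σ) (by simp)
    simp only [X]
    rw [map_mul, map_inv] at h
    rw [mul_inv_eq_iff_eq_mul]
    have h' := congrArg (fun y => g (swap (σ L) L) * y * (g σ)⁻¹ * g (swap (σ L) L)) h
    simp only [mul_assoc, mul_inv_cancel_left, inv_mul_cancel, mul_one, inv_mul_cancel_left] at h' ⊢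
    simpa using h'
  have hXL : X L = x := by simpa using hX 1
  have hXc : ∀ σ j, g σ * X j * (g σ)⁻¹ = X (σ j) := by
    intro σ j
    have e1 := hX (swap j L)
    have e2 := hX (σ * swap j L)
    rw [Perm.mul_apply] at e2
    rw [swap_apply_right] at e1 e2
    rw [e1, e2, map_mul]; group
  have Xt : ∀ i j, Commute (X i) (t j) := by
    intro i j
    have : t j = g (swap i L) * t (swap i L j) * (g (swap i L))⁻¹ := by
      rw [ct, swap_apply_self]; group
    rw [this]
    exact (Commute.conj_iff _).2 (xt _)
  -- commutation of the two last
  have key : Commute (X L) (X (L-1)) := by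
    have e0 : p * s 1 = s 0 * p := by simpa using h4 1
    have e1 : p * s 0 = s L * p := by
      have := h4 0
      rwa [show (0 : Fin (m+2)) - 1 = L by rw [← hL1]; simp] at this
    have e2 : p * p * s 1 = s L * (p * p) := by
      rw [mul_assoc, e0, ← mul_assoc, e1, mul_assoc]
    have e3 : p * p = X L * X (L-1) * g (c * c) := by
      have := hXc c L
      rw [hcj] at this
      rw [← this, hXL, map_mul]
      nth_rewrite 1 [hp]
      nth_rewrite 1 [hp]
      group
    have e4 : g (c * c) * s 1 = s L * g (c * c) := by
      rw [← hg 1 h01, ← hg L hL0, ← map_mul, ← map_mul]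
      congr 1
      have := swap_apply_apply (c*c) (1-1) 1
      rw [← mul_inv_eq_iff_eq_mul, ← this]
      congr 1
      · simp only [Perm.mul_apply, hcj]; rw [sub_self, ← hL1]; abel
      · simp only [Perm.mul_apply, hcj]; rw [sub_self, ← hL1]; abel
    have e5 : Commute (X L * X (L-1)) (s L) := by
      rw [e3] at e2
      generalize X L * X (L-1) = Y at e2 ⊢
      rw [mul_assoc, e4, ← mul_assoc, ← mul_assoc] at e2
      exact mul_right_cancel e2
    have e6 : s L * X L * (s L)⁻¹ = X (L-1) := by
      have := hXc (swap (L-1) L) L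
      rwa [hg L hL0, swap_apply_right] at this
    have e7 : s L * X (L-1) * (s L)⁻¹ = X L := by
      have := hXc (swap (L-1) L) (L-1)
      rwa [hg L hL0, swap_apply_left] at this
    have e8 : s L * (X L * X (L-1)) * (s L)⁻¹ = X L * X (L-1) := by
      rw [← e5.eq]; group
    have e9 : s L * (X L * X (L-1)) * (s L)⁻¹ = X (L-1) * X L := by
      calc s L * (X L * X (L-1)) * (s L)⁻¹
          = (s L * X L * (s L)⁻¹) * (s L * X (L-1) * (s L)⁻¹) := by group
        _ = _ := by rw [e6, e7]
    exact e8.symm.trans e9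
  have XX : ∀ a b, Commute (X a) (X b) := by
    intro a b
    by_cases hab : a = b
    · subst hab; exact Commute.refl _
    let σ1 := swap a L
    have hb' : L ≠ σ1 b := by
      intro h
      apply hab
      have : σ1 a = L := by simp [σ1]
      exact σ1.injective (this.trans h)
    let σ := σ1 * swap (σ1 b) (L-1)
    have ha : σ L = a := by
      simp only [σ, Perm.mul_apply]
      rw [swap_apply_of_ne_of_ne hb' hLL]; simp [σ1]
    have hb : σ (L-1) = b := by
      simp only [σ, Perm.mul_apply]
      rw [swap_apply_right]; simp [σ1]
    rw [← ha, ← hb, ← hXc, ← hXc]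
    exact (Commute.conj_iff _).2 key
  choose f hf using fun j => exists_hom_M r (t j) (X j) (h5 j) (Xt j j).symm
  have hfc : Pairwise fun i j => ∀ y z, Commute (f i y) (f j z) := by
    intro i j _ y z
    obtain ⟨a, b, rfl⟩ := M_surj r y
    obtain ⟨a', b', rfl⟩ := M_surj r z
    rw [hf, hf]
    have tt : Commute (t i) (t j) := h6 i j
    exact Commute.mul_left
      (Commute.mul_right (tt.zpow_zpow _ _) ((Xt j i).symm.zpow_zpow _ _))
      (Commute.mul_right ((Xt i j).zpow_zpow _ _) ((XX i j).zpow_zpow _ _))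
  let F := MonoidHom.noncommPiCoprod f hfc
  have hF : ∀ j z, F (Pi.mulSingle j z) = f j z := fun j z =>
    MonoidHom.noncommPiCoprod_mulSingle f j z
  have hcompat : ∀ σ : Perm (Fin (m+2)), F.comp (MulEquiv.toMonoidHom (permAut _ _ σ)) =
      (MulEquiv.toMonoidHom (MulAut.conj (g σ))).comp F := by
    intro σ
    apply MonoidHom.pi_ext
    intro j z
    show F (permAut _ _ σ (Pi.mulSingle j z)) = g σ * F (Pi.mulSingle j z) * (g σ)⁻¹
    rw [permAut_mulSingle, hF, hF]
    obtain ⟨a, b, rfl⟩ := M_surj r z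
    rw [hf, hf, ← hXc, show t (σ j) = g σ * t j * (g σ)⁻¹ by rw [ct]; group,
      conj_zpow, conj_zpow]
    group
  refine ⟨SemidirectProduct.lift F g hcompat, x, ?_, ?_, ?_, ?_⟩
  · intro j
    rw [SemidirectProduct.lift_inl, hF]
    simpa using hf j 1 0
  · rw [SemidirectProduct.lift_inl, hF]
    have := hf L 0 1
    rw [hXL] at this
    simpa using this
  · intro i hi
    rw [SemidirectProduct.lift_inr, hg i hi]
  · rw [SemidirectProduct.lift_inr]; exact hp

theorem inr_single (r m : ℕ) (σ : Perm (Fin (m+2))) (j : Fin (m+2))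
    (z : Multiplicative (ZMod r) × Multiplicative ℤ) :
    (SemidirectProduct.inr σ * SemidirectProduct.inl (Pi.mulSingle j z) : WTilde r (m+2)) =
    SemidirectProduct.inl (Pi.mulSingle (σ j) z) * SemidirectProduct.inr σ := by
  have := SemidirectProduct.inl_aut
    (φ := permAut (Fin (m+2)) (Multiplicative (ZMod r) × Multiplicative ℤ)) σ (Pi.mulSingle j z)
  rw [permAut_mulSingle] at this
  rw [this]; simp [mul_assoc]

theorem exists_avoid (m : ℕ) (hm : 1 ≤ m) (i j : Fin (m+2)) : ∃ k, i + k ≠ 0 ∧ j + k ≠ 0 := by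
  by_contra h
  push Not at h
  have h2 : (Finset.univ : Finset (Fin (m+2))) ⊆ {-i, -j} := by
    intro k _
    by_cases hk : i + k = 0
    · simp [(neg_eq_of_add_eq_zero_right hk)]
    · simp [(neg_eq_of_add_eq_zero_right (h k hk))]
  have := (Finset.card_le_card h2).trans Finset.card_le_two
  simp at this
  omega

theorem exists_phi (r m : ℕ) (hm : 1 ≤ m) (T : Fin (m+2) → WTilde r (m+2)) (P : WTilde r (m+2))
    (hT : ∀ j, T j = SemidirectProduct.inl
        (Pi.mulSingle j (Multiplicative.ofAdd 1, Multiplicative.ofAdd 0)))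
    (hP : P = SemidirectProduct.inl
        (Pi.mulSingle (Fin.last (m+1)) (Multiplicative.ofAdd 0, Multiplicative.ofAdd 1)) *
        SemidirectProduct.inr (Equiv.subRight 1)) :
    ∃ S : Fin (m+2) → WTilde r (m+2),
    (∀ i, i ≠ 0 → S i = SemidirectProduct.inr (swap (i-1) i)) ∧
    (∀ i, S i * S i = 1) ∧
    (∀ i j, i ≠ j + 1 → j ≠ i + 1 → S i * S j = S j * S i) ∧
    (∀ i, S i * S (i+1) * S i = S (i+1) * S i * S (i+1)) ∧
    (∀ i, P * S i = S (i-1) * P) ∧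
    (∀ j, T j ^ r = 1) ∧
    (∀ j k, T j * T k = T k * T j) ∧
    (∀ i j, i ≠ 0 → S i * T j = T (swap (i-1) i j) * S i) ∧
    (∀ j, P * T j = T (j-1) * P) := by
  set L : Fin (m+2) := Fin.last (m+1) with hL
  have hL0 : L ≠ 0 := by simp [hL, Fin.ext_iff]
  have hL1 : L + 1 = 0 := by simp [hL]
  have h0L : (0 : Fin (m+2)) - 1 = L := by rw [← hL1]; simp
  have h01 : (1 : Fin (m+2)) ≠ 0 := by simp
  have h02 : (1 : Fin (m+2)) + 1 ≠ 0 := by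
    rw [← hL1]
    intro h
    have := add_right_cancel h
    simp [hL, Fin.ext_iff] at this
    omega
  set c : Perm (Fin (m+2)) := Equiv.subRight 1 with hc
  have hcj : ∀ j, c j = j - 1 := fun j => rfl
  let X : Fin (m+2) → WTilde r (m+2) := fun j => SemidirectProduct.inl
        (Pi.mulSingle j (Multiplicative.ofAdd 0, Multiplicative.ofAdd 1))
  have hP' : P = X L * SemidirectProduct.inr c := hP
  have inlc : ∀ a b, (SemidirectProduct.inl a * SemidirectProduct.inl b : WTilde r (m+2)) =
      SemidirectProduct.inl b * SemidirectProduct.inl a := by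
    intro a b; rw [← map_mul, ← map_mul, mul_comm]
  have hXσ : ∀ σ j, (SemidirectProduct.inr σ * X j : WTilde r (m+2)) =
    X (σ j) * SemidirectProduct.inr σ := fun σ j => inr_single r m σ j _
  have hTσ : ∀ σ j, (SemidirectProduct.inr σ * T j : WTilde r (m+2)) =
    T (σ j) * SemidirectProduct.inr σ := fun σ j => by
      rw [hT, hT]; exact inr_single r m σ j _
  let S : Fin (m+2) → WTilde r (m+2) := fun i =>
    if i = 0 then P * SemidirectProduct.inr (swap 0 1) * P⁻¹ else
      SemidirectProduct.inr (swap (i-1) i)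
  have hS : ∀ i, i ≠ 0 → S i = SemidirectProduct.inr (swap (i-1) i) := by
    intro i hi; simp only [S, if_neg hi]
  have hS0 : S 0 = P * SemidirectProduct.inr (swap 0 1) * P⁻¹ := by simp only [S, if_true]
  have hcs : ∀ a b, c * swap a b = swap (a-1) (b-1) * c := by
    intro a b
    have := swap_apply_apply c a b
    rw [hcj, hcj] at this
    rw [this]; group
  have h4 : ∀ i, P * S i = S (i-1) * P := by
    intro i
    by_cases hi0 : i = 0
    · subst hi0
      rw [h0L, hS L hL0, hS0, ← mul_assoc, ← mul_assoc, mul_inv_eq_iff_eq_mul]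
      have e3 : P * P = X L * X (L-1) * SemidirectProduct.inr (c * c) := by
        have := hXσ c L
        rw [hcj] at this
        rw [map_mul]
        calc P * P = X L * (SemidirectProduct.inr c * X L) * SemidirectProduct.inr c := by
              rw [hP']; group
          _ = _ := by rw [this]; group
      have e4 : c * c * swap 0 1 = swap (L-1) L * (c * c) := by
        rw [mul_assoc, hcs, sub_self, h0L, ← mul_assoc, hcs, h0L, mul_assoc]
      have e4' : (SemidirectProduct.inr (c * c) * SemidirectProduct.inr (swap 0 1) :
          WTilde r (m+2)) =
          SemidirectProduct.inr (swap (L-1) L) * SemidirectProduct.inr (c * c) := by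
        rw [← map_mul, e4, map_mul]
      have f1 := hXσ (swap (L-1) L) L
      have f2 := hXσ (swap (L-1) L) (L-1)
      have f3 : X L * X (L-1) = X (L-1) * X L := inlc _ _
      rw [swap_apply_right] at f1
      rw [swap_apply_left] at f2
      clear_value X
      rw [mul_assoc _ P P, e3, mul_assoc (X L * X (L-1)), e4', ← mul_assoc, ← mul_assoc]
      congr 1
      rw [← mul_assoc, f1, mul_assoc (X (L-1)), f2, ← mul_assoc, f3]
    by_cases hi1 : i = 1
    · subst hi1
      rw [sub_self, hS0, hS 1 h01, sub_self]; group
    · have hi' : i - 1 ≠ 0 := sub_ne_zero.2 hi1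
      rw [hS i hi0, hS _ hi', hP', mul_assoc, ← map_mul, hcs, map_mul, ← mul_assoc, ← mul_assoc,
        hXσ, swap_apply_of_ne_of_ne]
      · rw [← h0L]; intro h; exact hi' (by simpa using h.symm)
      · rw [← h0L]; intro h; exact hi0 (by simpa using h.symm)
  have shift : ∀ k : Fin (m+2), ∃ Q, ∀ i, S i = Q * S (i + k) * Q⁻¹ := by
    intro k
    induction k using Fin.induction with
    | zero => exact ⟨1, by simp⟩
    | succ k ih =>
      obtain ⟨Q, hQ⟩ := ih
      refine ⟨Q * P, ?_⟩
      intro i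
      have := h4 (i + k.castSucc + 1)
      rw [add_sub_cancel_right] at this
      rw [hQ i, ← Fin.coeSucc_eq_succ, ← add_assoc, mul_inv_rev, mul_assoc Q P, this]
      group
  have h2' : ∀ i j, i ≠ 0 → j ≠ 0 → i ≠ j + 1 → j ≠ i + 1 → S i * S j = S j * S i := by
    intro i j hi hj hij hji
    by_cases h : i = j
    · rw [h]
    rw [hS i hi, hS j hj, ← map_mul, ← map_mul]
    congr 1
    refine (Perm.Disjoint.commute ?_)
    intro x
    by_cases hx1 : x = i - 1
    · right; subst hx1
      rw [swap_apply_of_ne_of_ne]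
      · intro h'; exact h (sub_left_injective h')
      · intro h'; exact hij (sub_eq_iff_eq_add.1 h')
    by_cases hx2 : x = i
    · right; subst hx2
      rw [swap_apply_of_ne_of_ne]
      · intro h'; exact hji (sub_eq_iff_eq_add.1 h'.symm)
      · exact h
    left; rw [swap_apply_of_ne_of_ne hx1 hx2]
  have h3' : ∀ i, i ≠ 0 → i + 1 ≠ 0 → S i * S (i+1) * S i = S (i+1) * S i * S (i+1) := by
    intro i hi hi'
    rw [hS i hi, hS _ hi', ← map_mul, ← map_mul, ← map_mul, ← map_mul, add_sub_cancel_right]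
    congr 1
    apply swap_braid
    · intro h; exact h01 (sub_eq_self.1 h)
    · intro h
      rw [sub_eq_iff_eq_add, add_assoc] at h
      exact h02 (by simpa using h.symm)
    · intro h; exact h01 (by simpa using h.symm)
  refine ⟨S, hS, ?_, ?_, ?_, h4, ?_, ?_, ?_, ?_⟩
  · intro i
    obtain ⟨k, hk, -⟩ := exists_avoid m hm i i
    obtain ⟨Q, hQ⟩ := shift k
    have e : S (i+k) * S (i+k) = 1 := by rw [hS _ hk, ← map_mul]; simp
    rw [hQ i]
    calc _ = Q * (S (i+k) * S (i+k)) * Q⁻¹ := by group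
      _ = 1 := by rw [e]; group
  · intro i j hij hji
    obtain ⟨k, hk, hk'⟩ := exists_avoid m hm i j
    obtain ⟨Q, hQ⟩ := shift k
    have e := h2' (i+k) (j+k) hk hk'
      (by intro h; apply hij; rw [add_right_comm] at h; exact add_right_cancel h)
      (by intro h; apply hji; rw [add_right_comm] at h; exact add_right_cancel h)
    rw [hQ i, hQ j]
    calc _ = Q * (S (i+k) * S (j+k)) * Q⁻¹ := by group
      _ = _ := by rw [e]; group
  · intro i
    obtain ⟨k, hk, hk'⟩ := exists_avoid m hm i (i+1)
    obtain ⟨Q, hQ⟩ := shift k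
    rw [add_right_comm] at hk'
    have e := h3' (i+k) hk hk'
    rw [hQ i, hQ (i+1), add_right_comm]
    calc _ = Q * (S (i+k) * S (i+k+1) * S (i+k)) * Q⁻¹ := by group
      _ = _ := by rw [e]; group
  · intro j
    rw [hT, ← map_pow, ← Pi.mulSingle_pow]
    have : ((Multiplicative.ofAdd 1, Multiplicative.ofAdd 0) :
        Multiplicative (ZMod r) × Multiplicative ℤ) ^ r = 1 := by
      ext
      · show Multiplicative.toAdd (Multiplicative.ofAdd (1 : ZMod r) ^ r) = 0
        rw [← ofAdd_nsmul]; simp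
      · simp
    rw [this]; simp
  · intro j k
    rw [hT, hT]; exact inlc _ _
  · intro i j hi
    rw [hS i hi, hTσ]
  · intro j
    rw [hP', mul_assoc, hTσ, hcj, ← mul_assoc, ← mul_assoc]
    congr 1
    rw [hT]; exact inlc _ _

/-- The group `Ŵ_{r,n}` presented by generators `t_1, …, t_n, ρ, s_0, …, s_{n-1}` and
the relations above is isomorphic to the semidirect product
`((ℤ/rℤ)^n × ℤ^n) ⋊ S_n`, where `S_n` acts diagonally by permuting coordinates. -/
theorem stmt8 (r n : ℕ) [NeZero r] [NeZero n] (hn : 3 ≤ n) :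
    Nonempty (PresentedGroup (WTrels r n) ≃* WTilde r n) := by
  obtain ⟨m, rfl⟩ : ∃ m, n = m + 2 := ⟨n - 2, by omega⟩
  have hm : 1 ≤ m := by omega
  obtain ⟨S, hS, h1, h2, h3, h4, h5, h6, h7, h8⟩ := exists_phi r m hm _ _ (fun j => rfl) rfl
  let T : Fin (m+2) → WTilde r (m+2) := fun j => SemidirectProduct.inl
        (Pi.mulSingle j (Multiplicative.ofAdd 1, Multiplicative.ofAdd 0))
  let X : WTilde r (m+2) := SemidirectProduct.inl
        (Pi.mulSingle (Fin.last (m+1)) (Multiplicative.ofAdd 0, Multiplicative.ofAdd 1))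
  let P : WTilde r (m+2) := X * SemidirectProduct.inr (Equiv.subRight 1)
  let F : Fin (m+2) ⊕ Option (Fin (m+2)) → WTilde r (m+2) := fun a =>
    match a with
    | Sum.inl j => T j
    | Sum.inr none => P
    | Sum.inr (some i) => S i
  have lT : ∀ j, FreeGroup.lift F (Tg (m+2) j) = T j := fun j => FreeGroup.lift_apply_of
  have lS : ∀ j, FreeGroup.lift F (Sg (m+2) j) = S j := fun j => FreeGroup.lift_apply_of
  have lP : FreeGroup.lift F (Pg (m+2)) = P := FreeGroup.lift_apply_of
  have hrels : ∀ w ∈ WTrels r (m+2), FreeGroup.lift F w = 1 := by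
    rintro w (((((((⟨i, rfl⟩ | ⟨i, j, hij, hji, rfl⟩) | ⟨i, rfl⟩) | ⟨i, rfl⟩) | ⟨j, rfl⟩) |
      ⟨j, k, rfl⟩) | ⟨i, j, hi, rfl⟩) | ⟨j, rfl⟩) <;>
      simp only [map_mul, map_inv, map_pow, lT, lS, lP, mul_inv_eq_one]
    · exact h1 i
    · exact h2 i j hij hji
    · exact h3 i
    · exact h4 i
    · exact h5 j
    · exact h6 j k
    · exact h7 i j hi
    · exact h8 j
  let φ : PresentedGroup (WTrels r (m+2)) →* WTilde r (m+2) := PresentedGroup.toGroup hrels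
  let q := PresentedGroup.mk (WTrels r (m+2))
  have hq : ∀ w ∈ WTrels r (m+2), q w = 1 := fun w hw => PresentedGroup.one_of_mem hw
  have hq2 : ∀ a b, a * b⁻¹ ∈ WTrels r (m+2) → q a = q b := by
    intro a b h
    have := hq _ h
    rwa [map_mul, map_inv, mul_inv_eq_one] at this
  have hφ : ∀ w, φ (q w) = FreeGroup.lift F w := fun w => rfl
  obtain ⟨ψ, x, p1, p2, p3, p4⟩ := exists_psi r m hm (fun j => q (Tg (m+2) j))
    (fun j => q (Sg (m+2) j)) (q (Pg (m+2)))
    (fun i => by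
      rw [← map_mul]
      exact hq _ (by iterate 7 left
                     exact ⟨i, rfl⟩))
    (fun i j hij hji => by
      rw [← map_mul, ← map_mul]
      exact hq2 _ _ (by iterate 6 left
                        right; exact ⟨i, j, hij, hji, rfl⟩))
    (fun i => by
      simp only [← map_mul]
      exact hq2 _ _ (by iterate 5 left
                        right; exact ⟨i, rfl⟩))
    (fun i => by
      simp only [← map_mul]
      exact hq2 _ _ (by iterate 4 left
                        right; exact ⟨i, rfl⟩))
    (fun i => by
      simp only [← map_pow]
      exact hq _ (by iterate 3 left
                     right; exact ⟨i, rfl⟩))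
    (fun i j => by
      simp only [← map_mul]
      exact hq2 _ _ (by iterate 2 left
                        right; exact ⟨i, j, rfl⟩))
    (fun i j hi => by
      simp only [← map_mul]
      exact hq2 _ _ (by left; right; exact ⟨i, j, hi, rfl⟩))
    (fun j => by
      simp only [← map_mul]
      exact hq2 _ _ (by right; exact ⟨j, rfl⟩))
  have h01 : (1 : Fin (m+2)) ≠ 0 := by simp
  have pP : ψ P = q (Pg (m+2)) := by
    rw [p4, ← p2, ← map_mul]
  have A : ψ.comp φ = MonoidHom.id _ := by
    have hs : ∀ i, i ≠ 0 → ψ (S i) = q (Sg (m+2) i) := by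
      intro i hi
      rw [hS i hi, p3 i hi]
    apply PresentedGroup.ext
    rintro (j | _ | i)
    · show ψ (φ (q (Tg (m+2) j))) = q (Tg (m+2) j)
      rw [hφ, lT]; exact p1 j
    · show ψ (φ (q (Pg (m+2)))) = q (Pg (m+2))
      rw [hφ, lP, pP]
    · show ψ (φ (q (Sg (m+2) i))) = q (Sg (m+2) i)
      rw [hφ, lS]
      by_cases hi : i = 0
      · subst hi
        have e1 : ψ P * ψ (S 1) = ψ (S (1 - 1)) * ψ P := by
          rw [← map_mul, ← map_mul]; exact congrArg ψ (h4 1)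
        have e2 : q (Pg (m+2)) * q (Sg (m+2) 1) = q (Sg (m+2) (1 - 1)) * q (Pg (m+2)) := by
          simp only [← map_mul]
          exact hq2 _ _ (by iterate 4 left
                            right; exact ⟨1, rfl⟩)
        rw [hs 1 h01, pP, e2, sub_self] at e1
        exact (mul_right_cancel e1).symm
      · exact hs i hi
  have hφψr : ∀ σ, φ (ψ (SemidirectProduct.inr σ)) = SemidirectProduct.inr σ := by
    intro σ
    refine perm_closure_ind m (fun σ => φ (ψ (SemidirectProduct.inr σ)) = SemidirectProduct.inr σ)
      (by simp) ?_ ?_ ?_ σ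
    · intro a b ha hb
      simp only [map_mul, ha, hb]
    · intro a ha
      simp only [map_inv, ha]
    · intro i hi
      rw [p3 i hi, hφ, lS, hS i hi]
  have hφψX : φ (ψ X) = X := by
    have e := congrArg φ p4
    rw [hφ, lP, map_mul, hφψr, ← p2] at e
    exact (mul_right_cancel e).symm
  have B : φ.comp ψ = MonoidHom.id _ := by
    apply SemidirectProduct.hom_ext
    · apply MonoidHom.pi_ext
      intro j z
      show φ (ψ (SemidirectProduct.inl (Pi.mulSingle j z))) = SemidirectProduct.inl _
      obtain ⟨a, b, rfl⟩ := M_surj r z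
      let Y : WTilde r (m+2) := SemidirectProduct.inl
        (Pi.mulSingle j (Multiplicative.ofAdd 0, Multiplicative.ofAdd 1))
      have hY : φ (ψ Y) = Y := by
        have e := inr_single r m (swap j (Fin.last (m+1))) (Fin.last (m+1))
          (Multiplicative.ofAdd 0, Multiplicative.ofAdd 1)
        rw [swap_apply_right] at e
        have e' := congrArg (fun y => φ (ψ y)) e
        simp only [map_mul, hφψr] at e'
        rw [show φ (ψ _) = X from hφψX] at e'
        exact (mul_right_cancel (e.symm.trans e')).symm
      have hTT : φ (ψ (T j)) = T j := by
        show φ (ψ (SemidirectProduct.inl _)) = _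
        rw [p1 j, hφ, lT]
      have dec : (SemidirectProduct.inl (Pi.mulSingle j
          (Multiplicative.ofAdd (a : ZMod r), Multiplicative.ofAdd b)) : WTilde r (m+2)) =
          T j ^ a * Y ^ b := by
        simp only [T, Y]
        rw [← map_zpow, ← map_zpow, ← map_mul, ← Pi.mulSingle_zpow, ← Pi.mulSingle_zpow,
          ← Pi.mulSingle_mul]
        congr 2
        ext
        · simp [← ofAdd_zsmul]
        · simp [← ofAdd_zsmul]
      rw [dec, map_mul, map_mul, map_zpow, map_zpow, map_zpow, map_zpow, hTT, hY]
    · ext1 σ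
      exact hφψr σ
  exact ⟨MonoidHom.toMulEquiv φ ψ A B⟩
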